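/- Let m = 6 and ℳ = (6^{i−1})_{i≥1}. For every integer k ≥ 2: r_ℳ(i,6,k) = 3·2^{k−1} for i ∈ {1,5}; r_ℳ(i,6,k) = 3·2^{k−1}·(2^{k−1} − 1) for i ∈ {2,4}; and r_ℳ(3,6,k) = 6·(3^{k−1} − 2^{k−1}). -/

import Mathlib

/-- `pM m k n` is the number of restricted `m`-ary partitions of `n` with parts
`1, m, m^2, …, m^(k-1)`. -/
noncomputable def pM (m k n : ℕ) : ℕ :=
  Nat.card {x : Fin k → ℕ // ∑ i : Fin k, x i * m ^ (i : ℕ) = n}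

/-- `rM i m k = #{n ∈ {0,…,m^k - 1} : p_ℳ(n,k) ≡ i (mod m)}`. -/
noncomputable def rM (i m k : ℕ) : ℕ :=
  ((Finset.range (m ^ k)).filter (fun n : ℕ => pM m k n % m = i)).card

/-- A restricted partition of `n` into `k + 1` parts is determined by the partition of some
`j ≤ n / m` obtained by forgetting the part `1`. -/
def restrictedPartitionEquiv {m : ℕ} (hm : 0 < m) (k n : ℕ) :
    {x : Fin (k + 1) → ℕ // ∑ i : Fin (k + 1), x i * m ^ (i : ℕ) = n} ≃
      Σ j : Fin (n / m + 1), {y : Fin k → ℕ // ∑ i : Fin k, y i * m ^ (i : ℕ) = j} where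
  toFun x := ⟨⟨∑ i : Fin k, x.1 i.succ * m ^ (i : ℕ), by
      rw [Nat.lt_succ_iff, Nat.le_div_iff_mul_le hm, Finset.sum_mul]
      conv_rhs => rw [← x.2, Fin.sum_univ_succ]
      simp [pow_succ, mul_assoc]⟩, ⟨fun i => x.1 i.succ, rfl⟩⟩
  invFun z := ⟨Fin.cons (n - z.1 * m) z.2.1, by
      obtain ⟨⟨j, hj⟩, y, hy⟩ := z
      have hjn : j * m ≤ n := (Nat.le_div_iff_mul_le hm).1 (Nat.lt_succ_iff.1 hj)
      simp only at hy
      simp only [Fin.sum_univ_succ, Fin.cons_zero, Fin.cons_succ, Fin.val_zero, Fin.val_succ,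
        pow_zero, mul_one, pow_succ, ← mul_assoc, ← Finset.sum_mul, hy]
      omega⟩
  left_inv x := by
    obtain ⟨x, rfl⟩ := x
    apply Subtype.ext
    funext i
    refine Fin.cases ?_ (fun i => ?_) i
    · simp [Fin.sum_univ_succ, pow_succ, ← mul_assoc, ← Finset.sum_mul]
    · simp
  right_inv z := by
    obtain ⟨⟨j, hj⟩, y, hy⟩ := z
    simp only at hy
    subst hy
    rfl

theorem finite_restrictedPartition {m : ℕ} (hm : 0 < m) (k n : ℕ) :
    Finite {x : Fin k → ℕ // ∑ i : Fin k, x i * m ^ (i : ℕ) = n} := by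
  induction k generalizing n with
  | zero => infer_instance
  | succ k ih => exact Finite.of_equiv _ (restrictedPartitionEquiv hm k n).symm

theorem pM_succ {m : ℕ} (hm : 0 < m) (k n : ℕ) :
    pM m (k + 1) n = ∑ j ∈ Finset.range (n / m + 1), pM m k j := by
  have := finite_restrictedPartition hm k
  rw [pM, Nat.card_congr (restrictedPartitionEquiv hm k n), Nat.card_sigma]
  exact Fin.sum_univ_eq_sum_range (pM m k) (n / m + 1)

theorem pM_zero_zero (m : ℕ) : pM m 0 0 = 1 := by
  simp [pM]

theorem pM_zero_succ (m n : ℕ) : pM m 0 (n + 1) = 0 := by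
  simp [pM]

theorem pM_one {m : ℕ} (hm : 0 < m) (n : ℕ) : pM m 1 n = 1 := by
  simp [pM_succ hm, Finset.sum_range_succ', pM_zero_zero, pM_zero_succ]

theorem pM_succ_mul_add {m r : ℕ} (hr : r < m) (k n : ℕ) :
    pM m (k + 1) (m * n + r) = pM m (k + 1) (m * n) := by
  have hm : 0 < m := by omega
  rw [pM_succ hm, pM_succ hm, Nat.mul_add_div hm, Nat.div_eq_of_lt hr, Nat.mul_div_cancel_left _ hm,
    add_zero]

theorem sum_range_mul_of_const_on_blocks {m : ℕ} {f : ℕ → ℕ}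
    (hf : ∀ q r, r < m → f (m * q + r) = f (m * q)) (n : ℕ) :
    ∑ j ∈ Finset.range (m * n), f j = m * ∑ q ∈ Finset.range n, f (m * q) := by
  induction n with
  | zero => simp
  | succ n ih =>
    rw [mul_add_one, Finset.sum_range_add, ih, Finset.sum_range_succ, mul_add,
      Finset.sum_congr rfl fun r hr => hf n r (Finset.mem_range.1 hr)]
    simp

/-- Modulo `m`, the last digit `s` of `n = m * q + s` contributes a factor `s + 1` to the number of
restricted partitions of `m * n`. -/
theorem pM_mul_modEq {m s : ℕ} (hs : s < m) (k q : ℕ) :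
    pM m (k + 2) (m * (m * q + s)) ≡ (s + 1) * pM m (k + 1) (m * q) [MOD m] := by
  have hm : 0 < m := by omega
  have hf := fun q r (hr : r < m) => pM_succ_mul_add hr k q
  rw [pM_succ hm, Nat.mul_div_cancel_left _ hm, add_assoc, Finset.sum_range_add,
    sum_range_mul_of_const_on_blocks hf,
    Finset.sum_congr rfl fun r hr => hf q r (by have := Finset.mem_range.1 hr; omega)]
  simp [Nat.ModEq]

theorem card_filter_range_mul (m N : ℕ) (p : ℕ → Prop) [DecidablePred p] :
    ((Finset.range (m * N)).filter p).card =
      ∑ n ∈ Finset.range N, ((Finset.range m).filter fun s => p (m * n + s)).card := by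
  simp only [Finset.card_filter]
  induction N with
  | zero => simp
  | succ N ih => rw [mul_add_one, Finset.sum_range_add, ih, Finset.sum_range_succ]

theorem rM_succ {m : ℕ} (i k : ℕ) :
    rM i m (k + 1) =
      m * ((Finset.range (m ^ k)).filter fun n => pM m (k + 1) (m * n) % m = i).card := by
  rw [rM, pow_succ', card_filter_range_mul, Finset.card_filter, Finset.mul_sum]
  refine Finset.sum_congr rfl fun n _ => ?_
  rw [Finset.filter_congr fun r hr => by rw [pM_succ_mul_add (Finset.mem_range.1 hr)]]
  split_ifs with h <;> simp [h]

/-- The residue counts satisfy a linear recursion, whose matrix counts the solutions `s` of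
`(s + 1) * j ≡ i`. -/
theorem rM_add_two {m : ℕ} (hm : 0 < m) (i k : ℕ) :
    rM i m (k + 2) = ∑ j ∈ Finset.range m,
      ((Finset.range m).filter fun s => (s + 1) * j % m = i).card * rM j m (k + 1) := by
  rw [rM_succ, pow_succ', card_filter_range_mul, Finset.mul_sum]
  simp only [rM_succ, Finset.card_filter _ (Finset.range (m ^ k)), Finset.mul_sum]
  rw [Finset.sum_comm]
  refine Finset.sum_congr rfl fun n _ => ?_
  rw [Finset.sum_eq_single (pM m (k + 1) (m * n) % m)]
  · rw [if_pos rfl, mul_one, mul_comm]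
    congr 2
    refine Finset.filter_congr fun s hs => ?_
    rw [pM_mul_modEq (Finset.mem_range.1 hs) k n, Nat.mul_mod_mod]
  · intro j _ hj
    simp [hj.symm]
  · intro h
    exact absurd (Finset.mem_range.2 (Nat.mod_lt _ hm)) h

theorem rM_six_one (i : ℕ) : rM i 6 1 = if i = 1 then 6 else 0 := by
  simp only [rM, pM_one (show 0 < 6 by norm_num)]
  split_ifs with h
  · subst h; rfl
  · simp [Ne.symm h]

theorem rM_six_add_two (k : ℕ) :
    rM 1 6 (k + 2) = rM 1 6 (k + 1) + rM 5 6 (k + 1) ∧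
    rM 5 6 (k + 2) = rM 1 6 (k + 1) + rM 5 6 (k + 1) ∧
    rM 2 6 (k + 2) = rM 1 6 (k + 1) + rM 5 6 (k + 1) + 2 * rM 2 6 (k + 1) + 2 * rM 4 6 (k + 1) ∧
    rM 4 6 (k + 2) = rM 1 6 (k + 1) + rM 5 6 (k + 1) + 2 * rM 2 6 (k + 1) + 2 * rM 4 6 (k + 1) ∧
    rM 3 6 (k + 2) = rM 1 6 (k + 1) + rM 5 6 (k + 1) + 3 * rM 3 6 (k + 1) := by
  have h6 : 0 < 6 := by norm_num
  refine ⟨?_, ?_, ?_, ?_, ?_⟩ <;> rw [rM_add_two h6] <;>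
    simp [Finset.sum_range_succ, Finset.card_filter, -Finset.sum_boole] <;> ring

theorem rM_six_closed_form (k : ℕ) :
    rM 1 6 (k + 2) = 3 * 2 ^ (k + 1) ∧
    rM 5 6 (k + 2) = 3 * 2 ^ (k + 1) ∧
    rM 2 6 (k + 2) + 3 * 2 ^ (k + 1) = 3 * 2 ^ (k + 1) * 2 ^ (k + 1) ∧
    rM 4 6 (k + 2) + 3 * 2 ^ (k + 1) = 3 * 2 ^ (k + 1) * 2 ^ (k + 1) ∧
    rM 3 6 (k + 2) + 6 * 2 ^ (k + 1) = 6 * 3 ^ (k + 1) := by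
  induction k with
  | zero =>
    obtain ⟨h1, h5, h2, h4, h3⟩ := rM_six_add_two 0
    simp [h1, h5, h2, h4, h3, rM_six_one]
  | succ k ih =>
    obtain ⟨h1, h5, h2, h4, h3⟩ := rM_six_add_two (k + 1)
    obtain ⟨i1, i5, i2, i4, i3⟩ := ih
    rw [h1, h5, h2, h4, h3, i1, i5]
    simp only [pow_succ _ (k + 1)]
    refine ⟨by ring, by ring, ?_, ?_, ?_⟩ <;> linarith

theorem stmt_16 (k : ℕ) (hk : 2 ≤ k) :
    (∀ i ∈ ({1, 5} : Finset ℕ), rM i 6 k = 3 * 2 ^ (k - 1)) ∧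
    (∀ i ∈ ({2, 4} : Finset ℕ), rM i 6 k = 3 * 2 ^ (k - 1) * (2 ^ (k - 1) - 1)) ∧
    rM 3 6 k = 6 * (3 ^ (k - 1) - 2 ^ (k - 1)) := by
  obtain ⟨k, rfl⟩ := Nat.exists_eq_add_of_le' hk
  obtain ⟨h1, h5, h2, h4, h3⟩ := rM_six_closed_form k
  rw [show k + 2 - 1 = k + 1 by omega, Nat.mul_sub, Nat.mul_sub, mul_one]
  simp only [Finset.mem_insert, Finset.mem_singleton, forall_eq_or_imp, forall_eq]
  exact ⟨⟨h1, h5⟩, ⟨Nat.eq_sub_of_add_eq h2, Nat.eq_sub_of_add_eq h4⟩, Nat.eq_sub_of_add_eq h3⟩
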